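/- Suppose T and each T_i (i = 1,…,m) are compact operators with closed range, c_i = 0 for every index i with T_i ≠ 0, the constraint set F is nonempty, and f is bounded from below on F. Then f attains its infimum on F. -/

import Mathlib

open scoped RealInnerProductSpace
open Filter Topology

/-- A sequence `x` in a real inner product space converges weakly to `x₀` if
`⟪a, x k⟫ → ⟪a, x₀⟫` for every `a`. -/
def WeaklyConvergesTo {H : Type*} [NormedAddCommGroup H] [InnerProductSpace ℝ H]
    (x : ℕ → H) (x₀ : H) : Prop :=
  ∀ a : H, Tendsto (fun k => ⟪a, x k⟫) atTop (𝓝 ⟪a, x₀⟫)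

/-- A (continuous linear) operator is compact if it maps every weakly convergent sequence
to a strongly convergent sequence. -/
def CompactOp {H : Type*} [NormedAddCommGroup H] [InnerProductSpace ℝ H]
    (A : H →L[ℝ] H) : Prop :=
  ∀ (x : ℕ → H) (x₀ : H), WeaklyConvergesTo x x₀ →
    Tendsto (fun k => A (x k)) atTop (𝓝 (A x₀))

section
variable {H : Type*} [NormedAddCommGroup H] [InnerProductSpace ℝ H]

theorem Orthonormal.weaklyConvergesTo_zero {e : ℕ → H} (he : Orthonormal ℝ e) :
    WeaklyConvergesTo e 0 := by
  intro a
  have h := (he.inner_products_summable a).tendsto_atTop_zero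
  have h2 : Tendsto (fun k => ‖⟪e k, a⟫‖) atTop (𝓝 0) := by
    have := h.sqrt
    simpa [Real.sqrt_sq_eq_abs] using this
  have h3 := tendsto_zero_iff_norm_tendsto_zero.mpr h2
  simpa [real_inner_comm] using h3

theorem exists_orthonormal_nat [CompleteSpace H] (h : ¬ FiniteDimensional ℝ H) :
    ∃ e : ℕ → H, Orthonormal ℝ e := by
  obtain ⟨w, b, hb⟩ := exists_hilbertBasis ℝ H
  have hw : Infinite w := by
    by_contra hfin
    rw [not_infinite_iff_finite] at hfin
    have := Fintype.ofFinite w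
    exact h b.toOrthonormalBasis.toBasis.finiteDimensional_of_finite
  exact ⟨b ∘ Infinite.natEmbedding w, b.orthonormal.comp _ (Infinite.natEmbedding w).injective⟩

theorem apply_starProjection_of_range_le (A : H →L[ℝ] H) (hsa : ∀ x y : H, ⟪A x, y⟫ = ⟪x, A y⟫)
    {V : Submodule ℝ H} [V.HasOrthogonalProjection] (hV : A.range ≤ V) (x : H) :
    A x = A (V.starProjection x) := by
  rw [← sub_eq_zero, ← map_sub]
  refine ext_inner_right ℝ fun y => ?_
  rw [hsa, inner_zero_left]
  exact V.starProjection_inner_eq_zero x _ (hV ⟨y, rfl⟩)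

theorem quadratic_starProjection (A : H →L[ℝ] H) (hsa : ∀ x y : H, ⟪A x, y⟫ = ⟪x, A y⟫)
    {V : Submodule ℝ H} [V.HasOrthogonalProjection] (hV : A.range ≤ V) {b : H} (hb : b ∈ V) (x : H) :
    (1/2 : ℝ) * ⟪x, A x⟫ + ⟪b, x⟫ =
      (1/2 : ℝ) * ⟪V.starProjection x, A (V.starProjection x)⟫ + ⟪b, V.starProjection x⟫ := by
  have h1 := V.starProjection_inner_eq_zero x b hb
  have h2 := V.starProjection_inner_eq_zero x (A x) (hV ⟨x, rfl⟩)
  rw [inner_sub_left] at h1 h2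
  rw [← apply_starProjection_of_range_le A hsa hV, real_inner_comm x b, real_inner_comm _ b]
  linarith

theorem CompactOp.finiteDimensional_range [CompleteSpace H] {A : H →L[ℝ] H} (hA : CompactOp A)
    (hsa : ∀ x y : H, ⟪A x, y⟫ = ⟪x, A y⟫) (hr : IsClosed (Set.range fun x => A x)) :
    FiniteDimensional ℝ A.range := by
  have hcl : IsClosed (A.range : Set H) := hr
  have := hcl.completeSpace_coe
  by_contra hfin
  obtain ⟨e, he⟩ := exists_orthonormal_nat hfin
  have he' : Orthonormal ℝ (fun k => (e k : H)) := he.comp_linearIsometry A.range.subtypeₗᵢ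
  have hlim : Tendsto (fun k => A (e k)) atTop (𝓝 0) := by
    simpa using hA _ _ he'.weaklyConvergesTo_zero
  let B : A.range →L[ℝ] H := A ∘L A.range.subtypeL
  have hinj : Function.Injective B := by
    rw [injective_iff_map_eq_zero]
    rintro ⟨_, y, rfl⟩ hy
    have hy' : A (A y) = 0 := hy
    have : ⟪A y, A y⟫ = 0 := by rw [hsa, hy', inner_zero_right]
    exact Subtype.ext (inner_self_eq_zero.mp this)
  have hrange : Set.range B = Set.range fun x => A x := by
    refine Set.Subset.antisymm (fun _ ⟨x, hx⟩ => ⟨x, hx⟩) ?_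
    rintro _ ⟨x, rfl⟩
    exact ⟨A.range.orthogonalProjectionOnto x,
      (apply_starProjection_of_range_le A hsa le_rfl x).symm⟩
  obtain ⟨K, hK⟩ := B.antilipschitz_of_injective_of_isClosed_range hinj (hrange ▸ hr)
  have hone : ∀ k, (1 : ℝ) ≤ K * ‖A (e k)‖ := fun k => by
    have := hK.le_mul_dist (e k) 0
    simpa [he.1 k, B] using this
  have h0 : Tendsto (fun k => (K : ℝ) * ‖A (e k)‖) atTop (𝓝 0) := by
    simpa using hlim.norm.const_mul (K : ℝ)
  have := ge_of_tendsto' h0 hone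
  linarith

theorem inner_quadratic_add (B : H →L[ℝ] H) (hB : ∀ x y : H, ⟪B x, y⟫ = ⟪x, B y⟫) (b x d : H)
    (t : ℝ) :
    (1/2 : ℝ) * ⟪x + t • d, B (x + t • d)⟫ + ⟪b, x + t • d⟫ =
      (1/2 : ℝ) * ⟪x, B x⟫ + ⟪b, x⟫ + (⟪x, B d⟫ + ⟪b, d⟫) * t + (1/2 : ℝ) * ⟪d, B d⟫ * t ^ 2 := by
  have h : ⟪d, B x⟫ = ⟪x, B d⟫ := by rw [← hB, real_inner_comm]
  simp only [map_add, map_smul, inner_add_left, inner_add_right, real_inner_smul_left,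
    real_inner_smul_right, h]
  ring

theorem apply_eq_zero_of_inner_apply_self_nonpos (B : H →L[ℝ] H)
    (hB : ∀ x y : H, ⟪B x, y⟫ = ⟪x, B y⟫) (hpos : ∀ x : H, 0 ≤ ⟪x, B x⟫) {d : H}
    (hd : ⟪d, B d⟫ ≤ 0) : B d = 0 := by
  have hd0 := le_antisymm hd (hpos d)
  have key : ∀ t : ℝ, 0 ≤ ⟪B d, B (B d)⟫ * (t * t) + (2 * ⟪B d, B d⟫) * t + 0 := by
    intro t
    have h1 := inner_quadratic_add B hB 0 d (B d) t
    have h2 := hpos (d + t • B d)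
    simp only [inner_zero_left, hd0, ← hB d (B d)] at h1
    linarith
  have := discrim_le_zero key
  simp only [discrim] at this
  have h3 : ⟪B d, B d⟫ = 0 := by nlinarith [sq_nonneg ⟪B d, B d⟫]
  exact inner_self_eq_zero.mp h3

theorem quadratic_coeffs_of_bddBelow {m a b q : ℝ} (hq : q ≤ 0)
    (h : ∀ t : ℝ, 0 ≤ t → m ≤ a + b * t + q * t ^ 2) : q = 0 ∧ 0 ≤ b := by
  have ha : m ≤ a := by simpa using h 0 le_rfl
  constructor
  · by_contra hne
    have hq' : 0 < -q := by
      rcases lt_or_eq_of_le hq with h | h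
      · linarith
      · exact absurd h hne
    have hr : 0 ≤ (|b| + (a - m) + 1) / (-q) :=
      div_nonneg (by linarith [abs_nonneg b]) hq'.le
    have hqr : q * ((|b| + (a - m) + 1) / (-q)) = -(|b| + (a - m) + 1) := by
      field_simp
    set r := (|b| + (a - m) + 1) / (-q)
    have h1 := h (1 + r) (by linarith)
    nlinarith [mul_le_mul_of_nonneg_right (le_abs_self b) (by linarith : 0 ≤ 1 + r),
      mul_nonneg hr (by linarith : 0 ≤ a - m)]
  · by_contra! hb
    have ht : 0 ≤ (a - m + 1) / (-b) := div_nonneg (by linarith) (by linarith)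
    have h1 := h _ ht
    have h2 : b * ((a - m + 1) / (-b)) = -(a - m + 1) := by
      rw [div_neg, mul_neg, mul_div_cancel₀ _ hb.ne]
    nlinarith [mul_nonneg (neg_nonneg.mpr hq) (sq_nonneg ((a - m + 1) / (-b)))]

theorem inner_limit_direction_nonpos {B : H →L[ℝ] H} {b d : H} {s : ℝ} {x : ℕ → H}
    (hx : ∀ k, (1/2 : ℝ) * ⟪x k, B (x k)⟫ + ⟪b, x k⟫ ≤ s)
    (hn : Tendsto (fun k => ‖x k‖) atTop atTop)
    (hd : Tendsto (fun k => ‖x k‖⁻¹ • x k) atTop (𝓝 d)) : ⟪d, B d⟫ ≤ 0 := by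
  have hi : Tendsto (fun k => ‖x k‖⁻¹) atTop (𝓝 0) := hn.inv_tendsto_atTop
  have h1 : Tendsto (fun k => (1/2 : ℝ) * ⟪‖x k‖⁻¹ • x k, B (‖x k‖⁻¹ • x k)⟫
      + ‖x k‖⁻¹ * ⟪b, ‖x k‖⁻¹ • x k⟫) atTop (𝓝 ((1/2 : ℝ) * ⟪d, B d⟫ + 0 * ⟪b, d⟫)) :=
    ((hd.inner ((B.continuous.tendsto d).comp hd)).const_mul _).add
      (hi.mul (tendsto_const_nhds.inner hd))
  have h2 : Tendsto (fun k => ‖x k‖⁻¹ * (‖x k‖⁻¹ * s)) atTop (𝓝 (0 * (0 * s))) :=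
    hi.mul (hi.mul_const s)
  have h3 := le_of_tendsto_of_tendsto' h1 h2 fun k => by
    have h := mul_le_mul_of_nonneg_left (hx k)
      (mul_nonneg (inv_nonneg.mpr (norm_nonneg (x k))) (inv_nonneg.mpr (norm_nonneg (x k))))
    simp only [map_smul, real_inner_smul_left, real_inner_smul_right]
    linarith
  linarith

theorem inner_limit_direction_nonpos_of_linear {b d : H} {s : ℝ} {x : ℕ → H}
    (hx : ∀ k, ⟪b, x k⟫ ≤ s) (hn : Tendsto (fun k => ‖x k‖) atTop atTop)
    (hd : Tendsto (fun k => ‖x k‖⁻¹ • x k) atTop (𝓝 d)) : ⟪b, d⟫ ≤ 0 := by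
  have h2 : Tendsto (fun k => ‖x k‖⁻¹ * s) atTop (𝓝 (0 * s)) :=
    hn.inv_tendsto_atTop.mul_const s
  have h3 := le_of_tendsto_of_tendsto' (tendsto_const_nhds.inner hd) h2 fun k => by
    rw [real_inner_smul_right]
    exact mul_le_mul_of_nonneg_left (hx k) (inv_nonneg.mpr (norm_nonneg (x k)))
  linarith

theorem inner_eq_norm_mul_inner_normalized (b x : H) :
    ⟪b, x⟫ = ‖x‖ * ⟪b, ‖x‖⁻¹ • x⟫ := by
  rcases eq_or_ne x 0 with rfl | hx
  · simp
  · rw [real_inner_smul_right, mul_inv_cancel_left₀ (norm_ne_zero_iff.mpr hx)]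

theorem exists_isMinOn_quadratic_of_properSpace [ProperSpace H] {ι : Type*} [Finite ι]
    (T : H →L[ℝ] H) (hT : ∀ x y : H, ⟪T x, y⟫ = ⟪x, T y⟫) (c : H)
    (A : ι → H →L[ℝ] H) (hA : ∀ i, ∀ x y : H, ⟪A i x, y⟫ = ⟪x, A i y⟫)
    (hpos : ∀ i, ∀ x : H, 0 ≤ ⟪x, A i x⟫) (b : ι → H) (α : ι → ℝ)
    (hb : ∀ i, A i = 0 ∨ b i = 0) {f : H → ℝ}
    (hf : ∀ x, f x = (1/2 : ℝ) * ⟪x, T x⟫ + ⟪c, x⟫) {F : Set H}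
    (hF : F = {x : H | ∀ i, (1/2 : ℝ) * ⟪x, A i x⟫ + ⟪b i, x⟫ + α i ≤ 0})
    (hne : F.Nonempty) (hbd : BddBelow (f '' F)) : ∃ x ∈ F, IsMinOn f F x := by
  have hfc : Continuous f := by
    rw [funext hf]
    fun_prop
  have hFc : IsClosed F := by
    rw [hF, Set.ofPred_forall]
    exact isClosed_iInter fun i => isClosed_le (by fun_prop) continuous_const
  set m := sInf (f '' F) with hm
  have hmle : ∀ x ∈ F, m ≤ f x := fun x hx => csInf_le hbd ⟨x, hx, rfl⟩
  have hex : ∀ k : ℕ, ∃ x ∈ F, f x ≤ m + 1 / ((k : ℝ) + 1) ∧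
      ∀ y ∈ F, f y ≤ m + 1 / ((k : ℝ) + 1) → ‖x‖ ≤ ‖y‖ := by
    intro k
    have hcl : IsClosed (F ∩ {x | f x ≤ m + 1 / ((k : ℝ) + 1)}) :=
      hFc.inter (isClosed_le hfc continuous_const)
    have hnon : (F ∩ {x | f x ≤ m + 1 / ((k : ℝ) + 1)}).Nonempty := by
      obtain ⟨_, ⟨x, hx, rfl⟩, hlt⟩ :=
        exists_lt_of_csInf_lt (hne.image f) (lt_add_of_pos_right m (Nat.one_div_pos_of_nat (n := k)))
      exact ⟨x, hx, hlt.le⟩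
    obtain ⟨x, hx, hdist⟩ := hcl.exists_infDist_eq_dist hnon 0
    refine ⟨x, hx.1, hx.2, fun y hy hfy => ?_⟩
    have := Metric.infDist_le_dist_of_mem (x := (0 : H)) 
      (show y ∈ F ∩ {x | f x ≤ m + 1 / ((k : ℝ) + 1)} from ⟨hy, hfy⟩)
    rwa [hdist, dist_zero_left, dist_zero_left] at this
  choose x hxF hxf hxmin using hex
  have hlim : Tendsto (fun k : ℕ => m + 1 / ((k : ℝ) + 1)) atTop (𝓝 m) := by
    simpa using tendsto_one_div_add_atTop_nhds_zero_nat.const_add m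
  by_cases hn : Tendsto (fun k => ‖x k‖) atTop atTop
  · exfalso
    obtain ⟨k₀, hk₀⟩ := (hn.eventually_gt_atTop 0).exists_forall_of_atTop
    have hsph : ∀ k, ‖x (k + k₀)‖⁻¹ • x (k + k₀) ∈ Metric.sphere (0 : H) 1 := fun k => by
      have := hk₀ (k + k₀) (by omega)
      rw [mem_sphere_zero_iff_norm, norm_smul, norm_inv, norm_norm, inv_mul_cancel₀ this.ne']
    obtain ⟨d, hd1, φ, hφ, hd⟩ := (isCompact_sphere (0 : H) 1).tendsto_subseq hsph
    set z : ℕ → H := fun k => x (φ k + k₀) with hz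
    replace hd : Tendsto (fun k => ‖z k‖⁻¹ • z k) atTop (𝓝 d) := hd
    have hzn : Tendsto (fun k => ‖z k‖) atTop atTop :=
      hn.comp ((tendsto_add_atTop_nat k₀).comp hφ.tendsto_atTop)
    have hzF : ∀ k i, (1/2 : ℝ) * ⟪z k, A i (z k)⟫ + ⟪b i, z k⟫ + α i ≤ 0 := fun k => by
      have : z k ∈ F := hxF _
      rwa [hF] at this
    have hAd : ∀ i, A i d = 0 := fun i =>
      apply_eq_zero_of_inner_apply_self_nonpos (A i) (hA i) (hpos i) <|
        inner_limit_direction_nonpos (b := b i) (s := -α i) (fun k => by linarith [hzF k i]) hzn hd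
    have hbd' : ∀ i, ⟪b i, d⟫ ≤ 0 := fun i => by
      refine inner_limit_direction_nonpos_of_linear (s := -α i) (fun k => ?_) hzn hd
      linarith [hzF k i, hpos i (z k)]
    have hTd : ⟪d, T d⟫ ≤ 0 := by
      refine inner_limit_direction_nonpos (b := c) (s := m + 1) (fun k => ?_) hzn hd
      rw [← hf]
      refine (hxf _).trans ?_
      gcongr
      rw [div_le_one (by positivity)]
      linarith [(Nat.cast_nonneg (φ k + k₀) : (0 : ℝ) ≤ _)]
    have hrec : ∀ y ∈ F, ∀ t : ℝ, 0 ≤ t → y + t • d ∈ F := fun y hy t ht => by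
      rw [hF] at hy ⊢
      intro i
      rw [inner_quadratic_add (A i) (hA i), hAd i]
      simp only [inner_zero_right]
      linarith [hy i, mul_nonneg (neg_nonneg.mpr (hbd' i)) ht]
    have hslope : ∀ y ∈ F, (1/2 : ℝ) * ⟪d, T d⟫ = 0 ∧ 0 ≤ ⟪y, T d⟫ + ⟪c, d⟫ := fun y hy => by
      refine quadratic_coeffs_of_bddBelow (m := m) (a := f y) (by linarith) fun t ht => ?_
      have := hmle _ (hrec y hy t ht)
      rwa [hf, inner_quadratic_add T hT, ← hf] at this
    have hev : ∀ i, ∀ᶠ k in atTop, z k + (-1 : ℝ) • d ∈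
        {y : H | (1/2 : ℝ) * ⟪y, A i y⟫ + ⟪b i, y⟫ + α i ≤ 0} := fun i => by
      simp only [Set.mem_ofPred_eq, inner_quadratic_add (A i) (hA i), hAd i, inner_zero_right]
      rcases (hbd' i).eq_or_lt with h0 | hlt
      · filter_upwards with k
        linarith [hzF k i]
      · have hAi : A i = 0 := (hb i).resolve_right fun h => by simp [h] at hlt
        have hbot : Tendsto (fun k => ⟪b i, z k⟫) atTop atBot := by
          simp_rw [fun k => inner_eq_norm_mul_inner_normalized (b i) (z k)]
          exact hzn.atTop_mul_neg hlt (tendsto_const_nhds.inner hd)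
        filter_upwards [hbot.eventually_le_atBot (⟪b i, d⟫ - α i)] with k hk
        simp only [hAi, zero_apply, inner_zero_right]
        linarith
    have hdn : ‖d‖ = 1 := mem_sphere_zero_iff_norm.mp hd1
    have htop : Tendsto (fun k => ⟪d, z k⟫) atTop atTop := by
      simp_rw [fun k => inner_eq_norm_mul_inner_normalized d (z k)]
      refine hzn.atTop_mul_pos (C := ⟪d, d⟫) ?_ (tendsto_const_nhds.inner hd)
      rw [real_inner_self_eq_norm_sq, hdn]
      norm_num
    obtain ⟨k, hkF, hkd⟩ := ((eventually_all.mpr hev).and (htop.eventually_gt_atTop 1)).exists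
    have hmem : z k + (-1 : ℝ) • d ∈ F := by
      rw [hF]
      exact hkF
    obtain ⟨hq, hs⟩ := hslope (z k) (hxF _)
    have hle : f (z k + (-1 : ℝ) • d) ≤ f (z k) := by
      rw [hf, inner_quadratic_add T hT, ← hf, hq]
      linarith
    have hnorm : ‖z k‖ ≤ ‖z k + (-1 : ℝ) • d‖ := hxmin _ _ hmem (hle.trans (hxf _))
    have hexp := norm_sub_sq_real (z k) d
    rw [neg_one_smul, ← sub_eq_add_neg] at hnorm
    rw [real_inner_comm, hdn] at hexp
    nlinarith [norm_nonneg (z k), norm_nonneg (z k - d)]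
  · obtain ⟨R, hR⟩ : ∃ R, ∃ᶠ k in atTop, ‖x k‖ < R := by
      simpa [tendsto_atTop, Filter.Frequently] using hn
    obtain ⟨y, -, φ, hφ, hy⟩ := tendsto_subseq_of_frequently_bounded
      (Metric.isBounded_ball (x := (0 : H)) (r := R)) (hR.mono fun k hk => by simpa using hk)
    refine ⟨y, hFc.mem_of_tendsto hy (.of_forall fun k => hxF _), fun w hw => ?_⟩
    have : f y ≤ m := le_of_tendsto_of_tendsto' ((hfc.tendsto y).comp hy)
      (hlim.comp hφ.tendsto_atTop) fun k => hxf _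
    exact this.trans (hmle w hw)

end

/-- If `T` and all `Tᵢ` are compact with closed range, `cᵢ = 0` whenever `Tᵢ ≠ 0`, `F` is
nonempty and `f` is bounded from below on `F`, then `f` attains its infimum on `F`. -/
theorem compact_ci_zero
    {H : Type*} [NormedAddCommGroup H] [InnerProductSpace ℝ H] [CompleteSpace H]
    {m : ℕ} (T : H →L[ℝ] H) (hT_sa : ∀ x y : H, ⟪T x, y⟫ = ⟪x, T y⟫) (c : H)
    (Ti : Fin m → H →L[ℝ] H)
    (hTi_sa : ∀ i, ∀ x y : H, ⟪Ti i x, y⟫ = ⟪x, Ti i y⟫)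
    (hTi_pos : ∀ i, ∀ x : H, 0 ≤ ⟪x, Ti i x⟫)
    (ci : Fin m → H) (α : Fin m → ℝ)
    (f : H → ℝ) (hf : ∀ x, f x = (1/2 : ℝ) * ⟪x, T x⟫ + ⟪c, x⟫)
    (F : Set H)
    (hF : F = {x : H | ∀ i, (1/2 : ℝ) * ⟪x, Ti i x⟫ + ⟪ci i, x⟫ + α i ≤ 0})
    (hTc : CompactOp T) (hTr : IsClosed (Set.range fun x => T x))
    (hTic : ∀ i, CompactOp (Ti i))
    (hTir : ∀ i, IsClosed (Set.range fun x => Ti i x))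
    (hc : ∀ i, Ti i ≠ 0 → ci i = 0)
    (hne : F.Nonempty) (hbd : BddBelow (f '' F)) :
    ∃ xbar ∈ F, ∀ x ∈ F, f xbar ≤ f x := by
  have := hTc.finiteDimensional_range hT_sa hTr
  have := fun i => (hTic i).finiteDimensional_range (hTi_sa i) (hTir i)
  let V : Submodule ℝ H := (T.range ⊔ ⨆ i, (Ti i).range) ⊔
    (Submodule.span ℝ {c} ⊔ Submodule.span ℝ (Set.range ci))
  have : FiniteDimensional ℝ (Submodule.span ℝ (Set.range ci)) :=
    FiniteDimensional.span_of_finite ℝ (Set.finite_range ci)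
  have : FiniteDimensional ℝ V := inferInstance
  have hVT : T.range ≤ V := le_sup_left.trans le_sup_left
  have hVTi : ∀ i, (Ti i).range ≤ V := fun i =>
    (le_iSup (fun i => (Ti i).range) i).trans (le_sup_right.trans le_sup_left)
  have hVc : c ∈ V :=
    (le_sup_left.trans le_sup_right : _ ≤ V) (Submodule.mem_span_singleton_self c)
  have hVci : ∀ i, ci i ∈ V := fun i =>
    (le_sup_right.trans le_sup_right : _ ≤ V) (Submodule.subset_span ⟨i, rfl⟩)
  have : ProperSpace V := FiniteDimensional.proper_real V
  have hproj : ∀ x, x ∈ F ↔ V.starProjection x ∈ F := fun x => by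
    simp only [hF, Set.mem_ofPred_eq]
    exact forall_congr' fun i => by
      rw [quadratic_starProjection (Ti i) (hTi_sa i) (hVTi i) (hVci i)]
  have hfproj : ∀ x, f x = f (V.starProjection x) := fun x => by
    rw [hf, hf, quadratic_starProjection T hT_sa hVT hVc]
  have hcomp : ∀ (A : H →L[ℝ] H) (x y : V),
      ⟪x, (V.orthogonalProjectionOnto ∘L A ∘L V.subtypeL) y⟫ = ⟪(x : H), A y⟫ := fun A x y =>
    V.inner_orthogonalProjectionOnto_eq_of_mem_left x (A y)
  have hcomp_symm : ∀ (A : H →L[ℝ] H), (∀ x y : H, ⟪A x, y⟫ = ⟪x, A y⟫) → ∀ x y : V,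
      ⟪(V.orthogonalProjectionOnto ∘L A ∘L V.subtypeL) x, y⟫ =
        ⟪x, (V.orthogonalProjectionOnto ∘L A ∘L V.subtypeL) y⟫ := fun A hA x y => by
    rw [real_inner_comm, hcomp, hcomp, ← hA, real_inner_comm]
  obtain ⟨x₀, hx₀⟩ := hne
  obtain ⟨y, hyF, hy⟩ := exists_isMinOn_quadratic_of_properSpace
    (V.orthogonalProjectionOnto ∘L T ∘L V.subtypeL) (hcomp_symm T hT_sa) ⟨c, hVc⟩
    (fun i => V.orthogonalProjectionOnto ∘L Ti i ∘L V.subtypeL)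
    (fun i => hcomp_symm _ (hTi_sa i)) (fun i x => by rw [hcomp]; exact hTi_pos i x)
    (fun i => ⟨ci i, hVci i⟩) α
    (fun i => by
      by_cases h : Ti i = 0
      · left
        simp [h]
      · right
        exact Subtype.ext (hc i h))
    (f := fun x : V => f x) (fun x => by rw [hf, hcomp]; rfl) (F := {x : V | (x : H) ∈ F})
    (by
      ext x
      simp only [hF, Set.mem_ofPred_eq, hcomp]
      rfl)
    ⟨V.orthogonalProjectionOnto x₀, (hproj x₀).mp hx₀⟩
    (hbd.mono (by
      rintro _ ⟨x, hx, rfl⟩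
      exact ⟨x, hx, rfl⟩))
  refine ⟨y, hyF, fun x hx => ?_⟩
  rw [hfproj x]
  exact hy (show V.orthogonalProjectionOnto x ∈ _ from (hproj x).mp hx)
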